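/- Let f : ℝ^d → ℝ be μ-strongly convex and L-smooth, let κ = L/μ, and let c ≥ 2 be a real constant. Let x, y : [0,∞) → ℝ^d be twice differentiable curves satisfying x''(t) = -∇f(x(t)) and y''(t) = -∇f(y(t)) with x'(0) = y'(0). Then with T = 1/(c√L), one has ‖x(T) - y(T)‖² ≤ (1 - 1/(4c²κ))·‖x(0) - y(0)‖². -/

import Mathlib

open Real
open scoped InnerProductSpace

section Calculus

theorem antitoneOn_Icc_of_hasDerivAt_nonpos {F F' : ℝ → ℝ} {a b : ℝ}
    (hF : ∀ t, a ≤ t → HasDerivAt F (F' t) t) (hF' : ∀ t ∈ Set.Icc a b, F' t ≤ 0) :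
    AntitoneOn F (Set.Icc a b) :=
  antitoneOn_of_hasDerivWithinAt_nonpos (convex_Icc a b)
    (fun t ht => (hF t ht.1).continuousAt.continuousWithinAt)
    (fun t ht => (hF t (interior_subset ht).1).hasDerivWithinAt)
    (fun t ht => hF' t (interior_subset ht))

end Calculus

section Smooth

variable {E : Type*} [NormedAddCommGroup E] [InnerProductSpace ℝ E] [CompleteSpace E]

/-- The descent lemma for a function with Lipschitz gradient. -/
theorem le_add_inner_gradient_add_sq {f : E → ℝ} {L : ℝ} (hf : Differentiable ℝ f)
    (hsmooth : ∀ a b : E, ‖gradient f a - gradient f b‖ ≤ L * ‖a - b‖) (a b : E) :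
    f b ≤ f a + ⟪gradient f a, b - a⟫_ℝ + L / 2 * ‖b - a‖ ^ 2 := by
  set v := b - a with hv
  have hline (s : ℝ) : HasDerivAt (fun s : ℝ => a + s • v) v s := by
    simpa using ((hasDerivAt_id s).smul_const v).const_add a
  have hcomp (s : ℝ) :
      HasDerivAt (fun s : ℝ => f (a + s • v)) ⟪gradient f (a + s • v), v⟫_ℝ s := by
    have h := (hf (a + s • v)).hasGradientAt.hasFDerivAt.comp_hasDerivAt s (hline s)
    rwa [InnerProductSpace.toDual_apply_apply] at h
  have hderiv (s : ℝ) : HasDerivAt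
      (fun s : ℝ => f (a + s • v) - s * ⟪gradient f a, v⟫_ℝ - L / 2 * ‖v‖ ^ 2 * s ^ 2)
      (⟪gradient f (a + s • v), v⟫_ℝ - ⟪gradient f a, v⟫_ℝ - L * ‖v‖ ^ 2 * s) s := by
    refine HasDerivAt.congr_deriv
      (((hcomp s).sub ((hasDerivAt_id s).mul_const ⟪gradient f a, v⟫_ℝ)).sub
        ((hasDerivAt_pow 2 s).const_mul (L / 2 * ‖v‖ ^ 2))) ?_
    simp
    ring
  have hanti := antitoneOn_Icc_of_hasDerivAt_nonpos (a := 0) (b := 1)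
    (fun s _ => hderiv s) (fun s hs => by
      have h1 : ⟪gradient f (a + s • v) - gradient f a, v⟫_ℝ
          ≤ ‖gradient f (a + s • v) - gradient f a‖ * ‖v‖ := real_inner_le_norm _ _
      have h2 := hsmooth (a + s • v) a
      rw [add_sub_cancel_left, norm_smul, Real.norm_of_nonneg hs.1] at h2
      rw [inner_sub_left] at h1
      nlinarith [norm_nonneg v])
  have h := hanti (Set.left_mem_Icc.2 zero_le_one) (Set.right_mem_Icc.2 zero_le_one) zero_le_one
  simp only [one_smul, zero_smul, add_zero, hv, add_sub_cancel] at h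
  simp only [hv]
  linarith

/-- Cocoercivity of the gradient of a convex function with `L`-Lipschitz gradient. -/
theorem sq_norm_gradient_sub_le {f : E → ℝ} {L : ℝ} (hL : 0 < L) (hf : Differentiable ℝ f)
    (hconv : ∀ a b : E, f a + ⟪gradient f a, b - a⟫_ℝ ≤ f b)
    (hsmooth : ∀ a b : E, ‖gradient f a - gradient f b‖ ≤ L * ‖a - b‖) (a b : E) :
    ‖gradient f a - gradient f b‖ ^ 2 ≤ L * ⟪gradient f a - gradient f b, a - b⟫_ℝ := by
  have key (p q : E) : f p + ⟪gradient f p, q - p⟫_ℝ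
      + 1 / (2 * L) * ‖gradient f q - gradient f p‖ ^ 2 ≤ f q := by
    set g := gradient f q - gradient f p with hg
    have h1 := hconv p (q - (1 / L) • g)
    have h2 := le_add_inner_gradient_add_sq hf hsmooth q (q - (1 / L) • g)
    have h3 : ⟪gradient f q, g⟫_ℝ - ⟪gradient f p, g⟫_ℝ = ‖g‖ ^ 2 := by
      rw [← inner_sub_left, ← hg, real_inner_self_eq_norm_sq]
    rw [sub_right_comm, inner_sub_right, real_inner_smul_right] at h1
    rw [sub_sub_cancel_left, inner_neg_right, real_inner_smul_right, norm_neg, norm_smul,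
      Real.norm_of_nonneg (by positivity)] at h2
    have h4 : L / 2 * (1 / L * ‖g‖) ^ 2 = 1 / (2 * L) * ‖g‖ ^ 2 := by field_simp
    have h5 : 1 / L * ⟪gradient f q, g⟫_ℝ - 1 / L * ⟪gradient f p, g⟫_ℝ
        = 2 * (1 / (2 * L) * ‖g‖ ^ 2) := by
      rw [← mul_sub, h3]; field_simp
    linarith
  have h1 := key a b
  have h2 := key b a
  rw [norm_sub_rev, ← neg_sub a b, inner_neg_right] at h1
  have h3 : 1 / L * ‖gradient f a - gradient f b‖ ^ 2
      ≤ ⟪gradient f a - gradient f b, a - b⟫_ℝ := by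
    have : 1 / L * ‖gradient f a - gradient f b‖ ^ 2
      = 2 * (1 / (2 * L) * ‖gradient f a - gradient f b‖ ^ 2) := by field_simp
    rw [inner_sub_left]
    linarith
  rwa [one_div, inv_mul_le_iff₀ hL] at h3

/-- Strong monotonicity of the gradient of a strongly convex function. -/
theorem sq_norm_sub_le_inner_gradient_sub {f : E → ℝ} {μ : ℝ}
    (hstrong : ∀ a b : E, f b ≥ f a + ⟪gradient f a, b - a⟫_ℝ + μ / 2 * ‖b - a‖ ^ 2) (a b : E) :
    μ * ‖a - b‖ ^ 2 ≤ ⟪gradient f a - gradient f b, a - b⟫_ℝ := by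
  have h1 := hstrong a b
  have h2 := hstrong b a
  rw [norm_sub_rev, ← neg_sub a b, inner_neg_right] at h1
  rw [inner_sub_left]
  linarith

end Smooth

section SecondOrder

variable {E : Type*} [NormedAddCommGroup E] [InnerProductSpace ℝ E]

/-- Contraction for `z'' = -g` started at rest, when the force `g` satisfies
`‖g‖² ≤ L⟪g, z⟫` and `μ‖z‖² ≤ ⟪g, z⟫`. -/
theorem sq_norm_mul_le_of_second_order {z w g : ℝ → E} {μ L T : ℝ} (hμ : 0 ≤ μ) (hL : 0 ≤ L)
    (hT : 0 ≤ T) (hLT : L * T ^ 2 ≤ 1 / 4)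
    (hz : ∀ t, 0 ≤ t → HasDerivAt z (w t) t) (hw : ∀ t, 0 ≤ t → HasDerivAt w (-g t) t)
    (hg : ContinuousOn g (Set.Ici 0)) (hw0 : w 0 = 0)
    (hcoco : ∀ t, 0 ≤ t → ‖g t‖ ^ 2 ≤ L * ⟪g t, z t⟫_ℝ)
    (hmono : ∀ t, 0 ≤ t → μ * ‖z t‖ ^ 2 ≤ ⟪g t, z t⟫_ℝ) :
    ‖z T‖ ^ 2 * (1 + 7 / 8 * μ * T ^ 2) ≤ ‖z 0‖ ^ 2 := by
  have hρc : ContinuousOn (fun t => ⟪g t, z t⟫_ℝ) (Set.Ici 0) :=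
    hg.inner (𝕜 := ℝ) fun t ht => (hz t ht).continuousAt.continuousWithinAt
  have hρm : Continuous fun t : ℝ => ⟪g (max t 0), z (max t 0)⟫_ℝ :=
    hρc.comp_continuous (f := fun t : ℝ => max t 0) (by fun_prop) fun t => le_max_right t 0
  -- `R` is the antiderivative of `⟪g, z⟫` vanishing at `0`.
  obtain ⟨R, hR0, hR⟩ : ∃ R : ℝ → ℝ, R 0 = 0 ∧
      ∀ t, 0 ≤ t → HasDerivAt R ⟪g t, z t⟫_ℝ t := by
    refine ⟨fun t => ∫ s in (0 : ℝ)..t, ⟪g (max s 0), z (max s 0)⟫_ℝ, by simp, fun t ht => ?_⟩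
    have h := (hρm.integral_hasStrictDerivAt 0 t).hasDerivAt
    rwa [max_eq_left ht] at h
  have hρ (t : ℝ) (ht : 0 ≤ t) : 0 ≤ ⟪g t, z t⟫_ℝ :=
    (by positivity : 0 ≤ μ * ‖z t‖ ^ 2).trans (hmono t ht)
  have compare {F F' : ℝ → ℝ} {t : ℝ} (ht : 0 ≤ t) (hF : ∀ s, 0 ≤ s → HasDerivAt F (F' s) s)
      (hF' : ∀ s ∈ Set.Icc 0 t, F' s ≤ 0) : F t ≤ F 0 :=
    antitoneOn_Icc_of_hasDerivAt_nonpos hF hF' (Set.left_mem_Icc.2 ht) (Set.right_mem_Icc.2 ht) ht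
  have hRnn (t : ℝ) (ht : 0 ≤ t) : 0 ≤ R t := by
    have h := compare ht (fun s hs => (hR s hs).neg)
      fun s hs => neg_nonpos.2 (hρ s hs.1)
    simp only [Pi.neg_apply, hR0] at h
    linarith
  have hwR (t : ℝ) (ht : 0 ≤ t) : ‖w t‖ ^ 2 ≤ t * L * R t := by
    rcases ht.eq_or_lt with rfl | htpos
    · simp [hw0]
    have h := compare ht (F := fun s => ⟪w s, w t⟫_ℝ - t * L / 2 * R s - ‖w t‖ ^ 2 / (2 * t) * s)
      (F' := fun s => ⟪-g s, w t⟫_ℝ - t * L / 2 * ⟪g s, z s⟫_ℝ - ‖w t‖ ^ 2 / (2 * t))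
      (fun s hs => by
        refine HasDerivAt.congr_deriv ((((hw s hs).inner ℝ (hasDerivAt_const s (w t))).sub
          ((hR s hs).const_mul (t * L / 2))).sub
          ((hasDerivAt_id s).const_mul (‖w t‖ ^ 2 / (2 * t)))) ?_
        simp)
      (fun s hs => by
        have h1 : -⟪g s, w t⟫_ℝ ≤ ‖g s‖ * ‖w t‖ :=
          (neg_le_abs _).trans (abs_real_inner_le_norm _ _)
        have h2 : ‖g s‖ * ‖w t‖ ≤ t / 2 * ‖g s‖ ^ 2 + ‖w t‖ ^ 2 / (2 * t) := by
          have h3 : t / 2 * ‖g s‖ ^ 2 + ‖w t‖ ^ 2 / (2 * t) - ‖g s‖ * ‖w t‖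
              = (t * ‖g s‖ - ‖w t‖) ^ 2 / (2 * t) := by field_simp; ring
          have : 0 ≤ (t * ‖g s‖ - ‖w t‖) ^ 2 / (2 * t) := by positivity
          linarith
        have h3 := mul_le_mul_of_nonneg_left (hcoco s hs.1) (by positivity : 0 ≤ t / 2)
        rw [inner_neg_left]
        linarith)
    have h4 : ‖w t‖ ^ 2 / (2 * t) * t = ‖w t‖ ^ 2 / 2 := by field_simp
    simp only [real_inner_self_eq_norm_sq, hw0, hR0, inner_zero_left, h4] at h
    linarith
  have hψ (t : ℝ) (ht : t ∈ Set.Icc 0 T) : ⟪z t, w t⟫_ℝ ≤ -(7 / 8) * R t := by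
    have h := compare ht.1 (F := fun s => ⟪z s, w s⟫_ℝ + R s - L / 2 * (s ^ 2 * R s))
      (F' := fun s => ⟪z s, -g s⟫_ℝ + ⟪w s, w s⟫_ℝ + ⟪g s, z s⟫_ℝ
        - L / 2 * (2 * s * R s + s ^ 2 * ⟪g s, z s⟫_ℝ))
      (fun s hs => by
        refine HasDerivAt.congr_deriv ((((hz s hs).inner ℝ (hw s hs)).add (hR s hs)).sub
          (((hasDerivAt_pow 2 s).mul (hR s hs)).const_mul (L / 2))) ?_
        simp)
      (fun s hs => by
        have h1 := hwR s hs.1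
        have h2 : 0 ≤ L / 2 * (s ^ 2 * ⟪g s, z s⟫_ℝ) :=
          mul_nonneg (by positivity) (mul_nonneg (by positivity) (hρ s hs.1))
        rw [inner_neg_right, real_inner_self_eq_norm_sq, real_inner_comm]
        linarith)
    simp only [hw0, hR0, inner_zero_right] at h
    have h1 : L * t ^ 2 ≤ 1 / 4 :=
      (mul_le_mul_of_nonneg_left (pow_le_pow_left₀ ht.1 ht.2 2) hL).trans hLT
    nlinarith [mul_le_mul_of_nonneg_right h1 (hRnn t ht.1)]
  have hφ (t : ℝ) (ht : 0 ≤ t) : HasDerivAt (fun s => ‖z s‖ ^ 2) (2 * ⟪z t, w t⟫_ℝ) t :=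
    (hz t ht).norm_sq
  have hψ' (t : ℝ) (ht : t ∈ Set.Icc 0 T) : 2 * ⟪z t, w t⟫_ℝ ≤ 0 := by
    linarith [hψ t ht, hRnn t ht.1]
  have hanti := antitoneOn_Icc_of_hasDerivAt_nonpos hφ hψ'
  have hRφ (t : ℝ) (ht : t ∈ Set.Icc 0 T) : μ * ‖z t‖ ^ 2 * t ≤ R t := by
    have h := compare ht.1 (F := fun s => μ * ‖z t‖ ^ 2 * s - R s)
      (F' := fun s => μ * ‖z t‖ ^ 2 - ⟪g s, z s⟫_ℝ)
      (fun s hs => by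
        refine HasDerivAt.congr_deriv
          (((hasDerivAt_id s).const_mul (μ * ‖z t‖ ^ 2)).sub (hR s hs)) ?_
        simp)
      (fun s hs => by
        have h1 := mul_le_mul_of_nonneg_left (hanti ⟨hs.1, hs.2.trans ht.2⟩ ht hs.2) hμ
        linarith [hmono s hs.1])
    simp only [hR0, mul_zero] at h
    linarith
  have h := compare hT (F := fun s => ‖z s‖ ^ 2 * (1 + 7 / 8 * μ * s ^ 2))
    (F' := fun s => 2 * ⟪z s, w s⟫_ℝ * (1 + 7 / 8 * μ * s ^ 2)
      + ‖z s‖ ^ 2 * (7 / 8 * μ * (2 * s)))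
    (fun s hs => by
      refine HasDerivAt.congr_deriv
        ((hφ s hs).mul (((hasDerivAt_pow 2 s).const_mul (7 / 8 * μ)).const_add 1)) ?_
      simp)
    (fun s hs => by
      have h1 : 2 * ⟪z s, w s⟫_ℝ * (7 / 8 * μ * s ^ 2) ≤ 0 :=
        mul_nonpos_of_nonpos_of_nonneg (hψ' s hs) (by positivity)
      linarith [hψ s hs, hRφ s hs])
  simpa using h

end SecondOrder

/-- **Contraction of ideal HMC with step size `T = 1/(c√L)`** :
if `f` is `μ`-strongly convex and `L`-smooth with condition number `κ = L/μ`, and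
`x, y` solve the Hamiltonian ODE `x'' = -∇f(x)` with equal initial velocities, then
`‖x(T) - y(T)‖² ≤ (1 - 1/(4c²κ))‖x(0) - y(0)‖²` for any constant `c ≥ 2`. -/
theorem hmc_contraction_step {d : ℕ} (μ L c κ T : ℝ) (hμ : 0 < μ) (hμL : μ ≤ L)
    (hc : 2 ≤ c) (hκ : κ = L / μ) (hT : T = 1 / (c * Real.sqrt L))
    (f : EuclideanSpace ℝ (Fin d) → ℝ) (hf : ContDiff ℝ 1 f)
    (hstrong : ∀ a b : EuclideanSpace ℝ (Fin d),
      f b ≥ f a + ⟪gradient f a, b - a⟫_ℝ + μ / 2 * ‖b - a‖ ^ 2)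
    (hsmooth : ∀ a b : EuclideanSpace ℝ (Fin d),
      ‖gradient f a - gradient f b‖ ≤ L * ‖a - b‖)
    (x y u v : ℝ → EuclideanSpace ℝ (Fin d))
    (hx : ∀ t, 0 ≤ t → HasDerivAt x (u t) t)
    (hu : ∀ t, 0 ≤ t → HasDerivAt u (-gradient f (x t)) t)
    (hy : ∀ t, 0 ≤ t → HasDerivAt y (v t) t)
    (hv : ∀ t, 0 ≤ t → HasDerivAt v (-gradient f (y t)) t)
    (h0 : u 0 = v 0) :
    ‖x T - y T‖ ^ 2 ≤ (1 - 1 / (4 * c ^ 2 * κ)) * ‖x 0 - y 0‖ ^ 2 := by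
  have hL : 0 < L := hμ.trans_le hμL
  have hc0 : 0 < c := by linarith
  have hsq : Real.sqrt L ^ 2 = L := Real.sq_sqrt hL.le
  have hT2 : T ^ 2 = 1 / (c ^ 2 * L) := by rw [hT, div_pow, mul_pow, hsq, one_pow]
  have hT0 : 0 ≤ T := by rw [hT]; positivity
  have hLT : L * T ^ 2 ≤ 1 / 4 := by
    have h : L * T ^ 2 = 1 / c ^ 2 := by rw [hT2]; field_simp
    rw [h]
    exact one_div_le_one_div_of_le (by norm_num) (by nlinarith)
  have hrate : 1 / (4 * c ^ 2 * κ) = μ * T ^ 2 / 4 := by rw [hκ, hT2]; field_simp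
  have hdiff : Differentiable ℝ f := hf.differentiable one_ne_zero
  have hgrad : Continuous (gradient f) :=
    (InnerProductSpace.toDual ℝ (EuclideanSpace ℝ (Fin d))).symm.continuous.comp
      (hf.continuous_fderiv one_ne_zero)
  have hconv (a b : EuclideanSpace ℝ (Fin d)) : f a + ⟪gradient f a, b - a⟫_ℝ ≤ f b := by
    have : 0 ≤ μ / 2 * ‖b - a‖ ^ 2 := by positivity
    linarith [hstrong a b]
  have hcont {p q : ℝ → EuclideanSpace ℝ (Fin d)} (hp : ∀ t, 0 ≤ t → HasDerivAt p (q t) t) :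
      ContinuousOn (fun t => gradient f (p t)) (Set.Ici 0) :=
    hgrad.comp_continuousOn fun t ht => (hp t ht).continuousAt.continuousWithinAt
  have key := sq_norm_mul_le_of_second_order (z := fun t => x t - y t) (w := fun t => u t - v t)
    (g := fun t => gradient f (x t) - gradient f (y t)) hμ.le hL.le hT0 hLT
    (fun t ht => (hx t ht).sub (hy t ht))
    (fun t ht => by
      refine HasDerivAt.congr_deriv ((hu t ht).sub (hv t ht)) ?_
      abel)
    ((hcont hx).sub (hcont hy)) (sub_eq_zero.2 h0)
    (fun t _ => sq_norm_gradient_sub_le hL hdiff hconv hsmooth (x t) (y t))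
    (fun t _ => sq_norm_sub_le_inner_gradient_sub hstrong (x t) (y t))
  have ha0 : 0 ≤ μ * T ^ 2 := by positivity
  have ha1 : μ * T ^ 2 ≤ 1 / 4 :=
    (mul_le_mul_of_nonneg_right hμL (sq_nonneg T)).trans hLT
  rw [hrate]
  calc ‖x T - y T‖ ^ 2
      ≤ ‖x T - y T‖ ^ 2 * ((1 - μ * T ^ 2 / 4) * (1 + 7 / 8 * μ * T ^ 2)) :=
        le_mul_of_one_le_right (by positivity) (by nlinarith)
    _ = (1 - μ * T ^ 2 / 4) * (‖x T - y T‖ ^ 2 * (1 + 7 / 8 * μ * T ^ 2)) := by ring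
    _ ≤ (1 - μ * T ^ 2 / 4) * ‖x 0 - y 0‖ ^ 2 :=
        mul_le_mul_of_nonneg_left key (by linarith)
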